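/- arXiv:2410.01410 — 4 statements merged into one kernel-verified Lean document; each statement's English description precedes it below -/
import Mathlib

section
/- Let f : ℝ^d → ℝ be differentiable, convex and L-smooth (∇f is L-Lipschitz, L > 0), fix γ > 0 and x ∈ ℝ^d, and let p = prox_{γf}(x) be the unique minimizer of A(z) = f(z) + ‖z − x‖²/(2γ). Let (z_t) be Nesterov's accelerated gradient iterates on A started from z₀ = z_{−1} = x: y_{t+1} = z_t + β(z_t − z_{t−1}) and z_{t+1} = y_{t+1} − η∇A(y_{t+1}), with step size η = γ/(1 + γL) and momentum β = (√(1 + γL) − 1)/(√(1 + γL) + 1). Then for every ε₂ ∈ (0, 1) and every natural number t with t ≥ √(1 + γL) · log(2(1 + γL)/ε₂), one has ‖z_t − p‖² ≤ ε₂ · ‖x − p‖². -/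
/-- Nesterov's one-step contraction of the Lyapunov function `A z - A p + μ / 2 * ‖v - p‖ ^ 2`
for a `μ`-strongly convex, `μ * s ^ 2`-smooth function. -/
theorem nesterov_lyapunov_step {E : Type*} [NormedAddCommGroup E] [InnerProductSpace ℝ E]
    {A : E → ℝ} {A' : E → E} {μ s : ℝ} (hμ : 0 < μ) (hs : 1 ≤ s)
    (hlower : ∀ u v, A u + inner ℝ (A' u) (v - u) + μ / 2 * ‖v - u‖ ^ 2 ≤ A v)
    (hupper : ∀ u v, A v ≤ A u + inner ℝ (A' u) (v - u) + μ * s ^ 2 / 2 * ‖v - u‖ ^ 2)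
    {p y z v z' v' : E} (hv : v = y + s • (y - z))
    (hz' : z' = y - (1 / (μ * s ^ 2)) • A' y) (hv' : v' = z + s • (z' - z)) :
    A z' - A p + μ / 2 * ‖v' - p‖ ^ 2 ≤
      (1 - 1 / s) * (A z - A p + μ / 2 * ‖v - p‖ ^ 2) := by
  have hs0 : 0 < s := by linarith
  have hlp := hlower y p
  have hlz := hlower y z
  have hd := hupper y z'
  set g := A' y
  set a := y - z with ha
  set b := y - p with hb
  have e1 : z' - y = -((1 / (μ * s ^ 2)) • g) := by rw [hz']; abel
  have e2 : v - p = b + s • a := by rw [hv, hb]; abel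
  have e3 : v' - p = b + (s - 1) • a - (1 / (μ * s)) • g := by
    have : s * (1 / (μ * s ^ 2)) = 1 / (μ * s) := by field_simp
    rw [hv', hz', ← this, mul_smul, ha, hb]
    module
  have e4 : p - y = -b := by rw [hb]; abel
  have e5 : z - y = -a := by rw [ha]; abel
  rw [e4, inner_neg_right, norm_neg] at hlp
  rw [e5, inner_neg_right, norm_neg] at hlz
  rw [e1, inner_neg_right, norm_neg, inner_smul_right, norm_smul, mul_pow, Real.norm_eq_abs,
    sq_abs, real_inner_self_eq_norm_sq] at hd
  have hd' : A z' ≤ A y - 1 / (2 * μ * s ^ 2) * ‖g‖ ^ 2 := by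
    convert hd using 1
    field_simp
    ring
  have n2 : ‖v - p‖ ^ 2 = ‖b‖ ^ 2 + 2 * s * inner ℝ a b + s ^ 2 * ‖a‖ ^ 2 := by
    rw [e2, norm_add_sq_real, inner_smul_right, norm_smul, mul_pow, Real.norm_eq_abs, sq_abs,
      real_inner_comm]
    ring
  have n3 : ‖v' - p‖ ^ 2 = ‖b‖ ^ 2 + 2 * (s - 1) * inner ℝ a b + (s - 1) ^ 2 * ‖a‖ ^ 2
      - 2 / (μ * s) * (inner ℝ g b + (s - 1) * inner ℝ g a) + 1 / (μ * s) ^ 2 * ‖g‖ ^ 2 := by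
    rw [e3, norm_sub_sq_real, norm_add_sq_real, inner_smul_right, inner_smul_right,
      inner_add_left, inner_smul_left, norm_smul, norm_smul, mul_pow, mul_pow, Real.norm_eq_abs,
      Real.norm_eq_abs, sq_abs, sq_abs, real_inner_comm a b, real_inner_comm g b,
      real_inner_comm g a]
    simp only [conj_trivial]
    ring
  rw [n2, n3]
  have hθ : 0 ≤ 1 - 1 / s := by
    rw [sub_nonneg, div_le_one hs0]; exact hs
  have k1 := mul_le_mul_of_nonneg_left hlp (one_div_pos.2 hs0).le
  have k2 := mul_le_mul_of_nonneg_left hlz hθ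
  have k3 : 0 ≤ (1 - 1 / s) * (μ / 2 * (s + 1) * ‖a‖ ^ 2) := by positivity
  have key : (1 - 1 / s) * (A z - A p + μ / 2 * (‖b‖ ^ 2 + 2 * s * inner ℝ a b + s ^ 2 * ‖a‖ ^ 2))
      - (A y - 1 / (2 * μ * s ^ 2) * ‖g‖ ^ 2 - A p + μ / 2 * (‖b‖ ^ 2 + 2 * (s - 1) * inner ℝ a b
        + (s - 1) ^ 2 * ‖a‖ ^ 2 - 2 / (μ * s) * (inner ℝ g b + (s - 1) * inner ℝ g a)
        + 1 / (μ * s) ^ 2 * ‖g‖ ^ 2))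
      = (1 / s * A p - 1 / s * (A y + -inner ℝ g b + μ / 2 * ‖b‖ ^ 2))
        + ((1 - 1 / s) * A z - (1 - 1 / s) * (A y + -inner ℝ g a + μ / 2 * ‖a‖ ^ 2))
        + (1 - 1 / s) * (μ / 2 * (s + 1) * ‖a‖ ^ 2) := by
    field_simp
    ring
  linarith

section Gradient

variable {E : Type*} [NormedAddCommGroup E] [InnerProductSpace ℝ E] [CompleteSpace E]
  {f : E → ℝ} {f' : E → E}

theorem hasDerivAt_comp_lineMap_of_hasGradientAt (hdiff : ∀ x, HasGradientAt f (f' x) x)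
    (u v : E) (t : ℝ) :
    HasDerivAt (fun t : ℝ => f (AffineMap.lineMap u v t))
      (inner ℝ (f' (AffineMap.lineMap u v t)) (v - u)) t := by
  have h := (hdiff (AffineMap.lineMap u v t)).hasFDerivAt.comp_hasDerivAt t
    (AffineMap.hasDerivAt_lineMap (a := u) (b := v) (x := t))
  simpa [Function.comp_def] using h

theorem ConvexOn.add_inner_gradient_le (hconv : ConvexOn ℝ Set.univ f)
    (hdiff : ∀ x, HasGradientAt f (f' x) x) (u v : E) :
    f u + inner ℝ (f' u) (v - u) ≤ f v := by
  have hc : ConvexOn ℝ Set.univ (fun t : ℝ => f (AffineMap.lineMap u v t)) := by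
    simpa [Function.comp_def] using hconv.comp_affineMap (AffineMap.lineMap u v)
  have h := hc.le_slope_of_hasDerivAt (Set.mem_univ 0) (Set.mem_univ 1) one_pos
    (hasDerivAt_comp_lineMap_of_hasGradientAt hdiff u v 0)
  simp [slope_def_field] at h
  linarith

theorem le_add_inner_gradient_add_sq {L : ℝ} (hdiff : ∀ x, HasGradientAt f (f' x) x)
    (hsmooth : ∀ u v, ‖f' u - f' v‖ ≤ L * ‖u - v‖) (u v : E) :
    f v ≤ f u + inner ℝ (f' u) (v - u) + L / 2 * ‖v - u‖ ^ 2 := by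
  let φ : ℝ → ℝ := fun t => f (AffineMap.lineMap u v t) - t * inner ℝ (f' u) (v - u)
    - L / 2 * ‖v - u‖ ^ 2 * t ^ 2
  have hφ (t : ℝ) : HasDerivAt φ (inner ℝ (f' (AffineMap.lineMap u v t)) (v - u)
      - inner ℝ (f' u) (v - u) - L * ‖v - u‖ ^ 2 * t) t := by
    have h := ((hasDerivAt_comp_lineMap_of_hasGradientAt hdiff u v t).sub
      ((hasDerivAt_id t).mul_const (inner ℝ (f' u) (v - u)))).sub
      ((hasDerivAt_pow 2 t).const_mul (L / 2 * ‖v - u‖ ^ 2))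
    refine h.congr_deriv ?_
    simp
    ring
  have hanti : AntitoneOn φ (Set.Icc 0 1) := by
    refine antitoneOn_of_deriv_nonpos (convex_Icc 0 1)
      (fun t _ => (hφ t).continuousAt.continuousWithinAt)
      (fun t _ => (hφ t).differentiableAt.differentiableWithinAt) fun t ht => ?_
    rw [interior_Icc] at ht
    rw [(hφ t).deriv, ← inner_sub_left]
    have h1 := real_inner_le_norm (f' (AffineMap.lineMap u v t) - f' u) (v - u)
    have h2 := hsmooth (AffineMap.lineMap u v t) u
    have h3 : ‖AffineMap.lineMap u v t - u‖ = t * ‖v - u‖ := by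
      rw [AffineMap.lineMap_apply_module', add_sub_cancel_right, norm_smul,
        Real.norm_of_nonneg ht.1.le]
    rw [h3] at h2
    nlinarith [mul_le_mul_of_nonneg_right h2 (norm_nonneg (v - u))]
  have h := hanti (Set.left_mem_Icc.2 zero_le_one) (Set.right_mem_Icc.2 zero_le_one) zero_le_one
  simp [φ] at h
  linarith

end Gradient

theorem norm_sub_sq_eq_expansion {E : Type*} [NormedAddCommGroup E] [InnerProductSpace ℝ E]
    (x u v : E) :
    ‖v - x‖ ^ 2 = ‖u - x‖ ^ 2 + 2 * inner ℝ (u - x) (v - u) + ‖v - u‖ ^ 2 := by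
  rw [← norm_add_sq_real]
  congr 2
  abel

theorem local_agd_rel
    {d : ℕ}
    (f : EuclideanSpace ℝ (Fin d) → ℝ)
    (f' : EuclideanSpace ℝ (Fin d) → EuclideanSpace ℝ (Fin d))
    (L : ℝ) (hL : 0 < L)
    (hdiff : ∀ x, HasGradientAt f (f' x) x)
    (hconv : ConvexOn ℝ Set.univ f)
    (hsmooth : ∀ u v, ‖f' u - f' v‖ ≤ L * ‖u - v‖)
    (γ : ℝ) (hγ : 0 < γ)
    (x p : EuclideanSpace ℝ (Fin d))
    (hp : IsMinOn (fun z => f z + ‖z - x‖ ^ 2 / (2 * γ)) Set.univ p)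
    (hpu : ∀ q, IsMinOn (fun z => f z + ‖z - x‖ ^ 2 / (2 * γ)) Set.univ q → q = p)
    (A' : EuclideanSpace ℝ (Fin d) → EuclideanSpace ℝ (Fin d))
    (hA' : ∀ z, A' z = f' z + (1 / γ) • (z - x))
    (η β : ℝ)
    (hη : η = γ / (1 + γ * L))
    (hβ : β = (Real.sqrt (1 + γ * L) - 1) / (Real.sqrt (1 + γ * L) + 1))
    (z y : ℕ → EuclideanSpace ℝ (Fin d))
    (hz0 : z 0 = x)
    (hy : ∀ t : ℕ, y (t + 1) = z t + β • (z t - (if t = 0 then x else z (t - 1))))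
    (hzrec : ∀ t : ℕ, z (t + 1) = y (t + 1) - η • A' (y (t + 1)))
    : ∀ ε₂ : ℝ, 0 < ε₂ → ε₂ < 1 → ∀ t : ℕ,
      Real.sqrt (1 + γ * L) * Real.log (2 * (1 + γ * L) / ε₂) ≤ (t : ℝ) →
        ‖z t - p‖ ^ 2 ≤ ε₂ * ‖x - p‖ ^ 2 := by
  intro ε₂ hε _ t ht
  set s := Real.sqrt (1 + γ * L) with hs_def
  have hγL : 0 < γ * L := mul_pos hγ hL
  have hs2 : s ^ 2 = 1 + γ * L := Real.sq_sqrt (by linarith)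
  have hs : 1 ≤ s := Real.one_le_sqrt.2 (by linarith)
  have hs0 : 0 < s := by linarith
  let A : EuclideanSpace ℝ (Fin d) → ℝ := fun z => f z + ‖z - x‖ ^ 2 / (2 * γ)
  have hexp (u v : EuclideanSpace ℝ (Fin d)) : A v = f v + (‖u - x‖ ^ 2 / (2 * γ)
      + inner ℝ (A' u - f' u) (v - u) + 1 / γ / 2 * ‖v - u‖ ^ 2) := by
    simp only [A]
    rw [hA', add_sub_cancel_left, real_inner_smul_left, norm_sub_sq_eq_expansion x u v]
    field_simp
  have hlower (u v) : A u + inner ℝ (A' u) (v - u) + 1 / γ / 2 * ‖v - u‖ ^ 2 ≤ A v := by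
    have h := hconv.add_inner_gradient_le hdiff u v
    rw [hexp u v, inner_sub_left]
    simp only [A]
    linarith
  have hupper (u v) : A v ≤ A u + inner ℝ (A' u) (v - u) + 1 / γ * s ^ 2 / 2 * ‖v - u‖ ^ 2 := by
    have h := le_add_inner_gradient_add_sq hdiff hsmooth u v
    have hM : 1 / γ * s ^ 2 / 2 = 1 / γ / 2 + L / 2 := by rw [hs2]; field_simp
    rw [hexp u v, inner_sub_left, hM]
    simp only [A]
    linarith
  have hgrad : A' p = 0 := by
    by_contra hne
    have h := hupper p (p - (1 / (1 / γ * s ^ 2)) • A' p)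
    have hmin : A p ≤ A (p - (1 / (1 / γ * s ^ 2)) • A' p) := hp (Set.mem_univ _)
    rw [sub_sub_cancel_left, inner_neg_right, norm_neg, real_inner_smul_right, norm_smul, mul_pow,
      Real.norm_eq_abs, sq_abs, real_inner_self_eq_norm_sq] at h
    have hpos : 0 < γ / (2 * s ^ 2) * ‖A' p‖ ^ 2 := by positivity
    have heq : -(1 / (1 / γ * s ^ 2) * ‖A' p‖ ^ 2)
        + 1 / γ * s ^ 2 / 2 * ((1 / (1 / γ * s ^ 2)) ^ 2 * ‖A' p‖ ^ 2)
        = -(γ / (2 * s ^ 2) * ‖A' p‖ ^ 2) := by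
      field_simp
      ring
    linarith
  let v : ℕ → EuclideanSpace ℝ (Fin d) := fun n =>
    z n + (s - 1) • (z n - if n = 0 then x else z (n - 1))
  have hv (n) : v n = y (n + 1) + s • (y (n + 1) - z n) := by
    have hβs : s - 1 = β + s * β := by rw [hβ]; field_simp; ring
    simp only [v]
    rw [hy n, hβs]
    module
  have hη' : η = 1 / (1 / γ * s ^ 2) := by rw [hη, hs2]; field_simp
  have hstep (n) := nesterov_lyapunov_step (p := p) (one_div_pos.2 hγ) hs hlower hupper (hv n)
    (hη' ▸ hzrec n) (v' := v (n + 1)) (by simp only [v]; simp; module)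
  have hθ : 0 ≤ 1 - 1 / s := by rw [sub_nonneg, div_le_one hs0]; exact hs
  have hV (n : ℕ) : A (z n) - A p + 1 / γ / 2 * ‖v n - p‖ ^ 2 ≤
      (1 - 1 / s) ^ n * (A x - A p + 1 / γ / 2 * ‖x - p‖ ^ 2) := by
    induction n with
    | zero => simp [v, hz0]
    | succ n ih =>
      rw [pow_succ' (1 - 1 / s), mul_assoc]
      exact (hstep n).trans (mul_le_mul_of_nonneg_left ih hθ)
  have hx := hupper p x
  have hzt := hlower p (z t)
  rw [hgrad, inner_zero_left] at hx hzt
  have hinit : A x - A p + 1 / γ / 2 * ‖x - p‖ ^ 2 ≤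
      1 / γ / 2 * (2 * (1 + γ * L) * ‖x - p‖ ^ 2) := by
    have : 0 ≤ 1 / γ / 2 * (γ * L * ‖x - p‖ ^ 2) := by positivity
    rw [hs2] at hx
    linarith
  have hrate : (1 - 1 / s) ^ t * (2 * (1 + γ * L)) ≤ ε₂ := by
    have hκ : 0 < 2 * (1 + γ * L) := by linarith
    have h1 : (1 - 1 / s) ^ t ≤ Real.exp (-(t / s)) := by
      calc (1 - 1 / s) ^ t ≤ Real.exp (-(1 / s)) ^ t :=
            pow_le_pow_left₀ hθ (Real.one_sub_le_exp_neg _) t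
        _ = Real.exp (-(t / s)) := by rw [← Real.exp_nat_mul]; congr 1; ring
    have h2 : Real.log (2 * (1 + γ * L) / ε₂) ≤ t / s := by
      rw [le_div_iff₀ hs0]; linarith
    have h3 : Real.exp (-(t / s)) ≤ ε₂ / (2 * (1 + γ * L)) := by
      rw [← Real.le_log_iff_exp_le (by positivity), ← inv_div (2 * (1 + γ * L)), Real.log_inv]
      linarith
    exact (le_div_iff₀ hκ).1 (h1.trans h3)
  have hfin : 1 / γ / 2 * ‖z t - p‖ ^ 2 ≤ 1 / γ / 2 * (ε₂ * ‖x - p‖ ^ 2) := by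
    have h1 : 0 ≤ 1 / γ / 2 * ‖v t - p‖ ^ 2 := by positivity
    have h2 := mul_le_mul_of_nonneg_left hinit (pow_nonneg hθ t)
    have h3 := mul_le_mul_of_nonneg_right hrate
      (show 0 ≤ 1 / γ / 2 * ‖x - p‖ ^ 2 by positivity)
    linarith [hV t]
  exact le_of_mul_le_mul_left hfin (by positivity)
end

section
/- Let f : ℝ^d → ℝ be differentiable and bounded below with infimum f_inf, with ∇f being L̂-Lipschitz (L̂ > 0), and assume f is μ̂-PL: ‖∇f(x)‖² ≥ 2μ̂(f(x) − f_inf) for all x, with μ̂ > 0. Let C : ℝ^d → ℝ^d be a (possibly biased) compression mapping of class B³(δ) for some δ ≥ 1, i.e., ‖C(x) − x‖² ≤ (1 − 1/δ)‖x‖² for all x ∈ ℝ^d. Let x_{k+1} = x_k − η C(∇f(x_k)) with 0 < η ≤ 1/L̂. Then for every k ≥ 0, f(x_k) − f_inf ≤ (1 − ημ̂/δ)^k (f(x₀) − f_inf). -/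
/-- The descent lemma: a function with `L`-Lipschitz gradient lies below its quadratic model. -/
theorem le_quadratic_of_lipschitz_gradient {E : Type*} [NormedAddCommGroup E]
    [InnerProductSpace ℝ E] [CompleteSpace E] {f : E → ℝ} {f' : E → E} {L : ℝ}
    (hf : ∀ x, HasGradientAt f (f' x) x) (hL : ∀ u v, ‖f' u - f' v‖ ≤ L * ‖u - v‖) (x v : E) :
    f (x + v) ≤ f x + inner ℝ (f' x) v + L / 2 * ‖v‖ ^ 2 := by
  let g : ℝ → ℝ := fun t => f (x + t • v) - t * inner ℝ (f' x) v - t ^ 2 * (L / 2 * ‖v‖ ^ 2)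
  have hg (t : ℝ) : HasDerivAt g (inner ℝ (f' (x + t • v)) v - inner ℝ (f' x) v
      - 2 * t * (L / 2 * ‖v‖ ^ 2)) t := by
    have hline : HasDerivAt (fun t : ℝ => x + t • v) v t := by
      simpa using ((hasDerivAt_id t).smul_const v).const_add x
    have hcomp : HasDerivAt (fun t : ℝ => f (x + t • v)) (inner ℝ (f' (x + t • v)) v) t := by
      simpa [Function.comp_def] using (hf (x + t • v)).hasFDerivAt.comp_hasDerivAt t hline
    have hlin := (hasDerivAt_id t).mul_const (inner ℝ (f' x) v)
    have hsq := (hasDerivAt_pow 2 t).mul_const (L / 2 * ‖v‖ ^ 2)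
    exact ((hcomp.sub hlin).sub hsq).congr_deriv (by simp)
  have hanti : AntitoneOn g (Set.Icc 0 1) := by
    refine antitoneOn_of_deriv_nonpos (convex_Icc 0 1)
      (fun t _ => (hg t).continuousAt.continuousWithinAt)
      (fun t _ => (hg t).differentiableAt.differentiableWithinAt) fun t ht => ?_
    rw [interior_Icc] at ht
    have hinner : inner ℝ (f' (x + t • v) - f' x) v ≤ L * ‖t • v‖ * ‖v‖ :=
      (real_inner_le_norm _ _).trans <| by
        gcongr
        simpa using hL (x + t • v) x
    rw [inner_sub_left, norm_smul, Real.norm_of_nonneg ht.1.le] at hinner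
    rw [(hg t).deriv]
    linarith
  have h01 := hanti (by simp) (by simp) zero_le_one
  simp only [g, one_smul, zero_smul, add_zero] at h01
  linarith

/-- One step along a direction `c` close to the gradient, with step size at most `1 / L`. -/
theorem inexact_gradient_step_le {E : Type*} [NormedAddCommGroup E]
    [InnerProductSpace ℝ E] [CompleteSpace E] {f : E → ℝ} {f' : E → E} {L η : ℝ}
    (hf : ∀ x, HasGradientAt f (f' x) x) (hL : ∀ u v, ‖f' u - f' v‖ ≤ L * ‖u - v‖)
    (hη : 0 ≤ η) (hηL : η * L ≤ 1) (x c : E) :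
    f (x - η • c) ≤ f x + η / 2 * (‖c - f' x‖ ^ 2 - ‖f' x‖ ^ 2) := by
  have h := le_quadratic_of_lipschitz_gradient hf hL x (-(η • c))
  rw [← sub_eq_add_neg, inner_neg_right, real_inner_smul_right, norm_neg, norm_smul,
    Real.norm_of_nonneg hη] at h
  have hc : η / 2 * ‖c‖ ^ 2 * (η * L) ≤ η / 2 * ‖c‖ ^ 2 :=
    mul_le_of_le_one_right (by positivity) hηL
  rw [norm_sub_sq_real, real_inner_comm]
  linarith

/-- A nonnegative sequence contracted by a factor `q` of any sign decays geometrically. -/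
theorem le_pow_mul_of_succ_le_mul {a : ℕ → ℝ} {q : ℝ} (ha : ∀ k, 0 ≤ a k)
    (h : ∀ k, a (k + 1) ≤ q * a k) (k : ℕ) : a k ≤ q ^ k * a 0 := by
  rcases le_or_gt 0 q with hq | hq
  · induction k with
    | zero => simp
    | succ k ih =>
      calc a (k + 1) ≤ q * a k := h k
        _ ≤ q * (q ^ k * a 0) := by gcongr
        _ = q ^ (k + 1) * a 0 := by ring
  · have hzero (j : ℕ) : a j = 0 :=
      le_antisymm (nonpos_of_mul_nonneg_right ((ha (j + 1)).trans (h j)) hq) (ha j)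
    simp [hzero]

theorem biased_cgd_pl
    {d : ℕ}
    (f : EuclideanSpace ℝ (Fin d) → ℝ)
    (f' : EuclideanSpace ℝ (Fin d) → EuclideanSpace ℝ (Fin d))
    (hdiff : ∀ x, HasGradientAt f (f' x) x)
    (finf : ℝ) (hfinf : IsGLB (Set.range f) finf)
    (Lhat : ℝ) (hLhat : 0 < Lhat)
    (hsmooth : ∀ u v, ‖f' u - f' v‖ ≤ Lhat * ‖u - v‖)
    (μhat : ℝ) (hμhat : 0 < μhat)
    (hPL : ∀ x, ‖f' x‖ ^ 2 ≥ 2 * μhat * (f x - finf))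
    (C : EuclideanSpace ℝ (Fin d) → EuclideanSpace ℝ (Fin d))
    (δ : ℝ) (hδ : 1 ≤ δ)
    (hB3 : ∀ v : EuclideanSpace ℝ (Fin d), ‖C v - v‖ ^ 2 ≤ (1 - 1 / δ) * ‖v‖ ^ 2)
    (η : ℝ) (hη : 0 < η) (hηle : η ≤ 1 / Lhat)
    (xseq : ℕ → EuclideanSpace ℝ (Fin d))
    (hrec : ∀ k : ℕ, xseq (k + 1) = xseq k - η • C (f' (xseq k)))
    : ∀ k : ℕ, f (xseq k) - finf ≤ (1 - η * μhat / δ) ^ k * (f (xseq 0) - finf) := by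
  refine le_pow_mul_of_succ_le_mul (a := fun k => f (xseq k) - finf)
    (fun k => sub_nonneg.2 (hfinf.1 ⟨_, rfl⟩)) fun k => ?_
  have hstep := inexact_gradient_step_le hdiff hsmooth hη.le ((le_div_iff₀ hLhat).1 hηle)
    (xseq k) (C (f' (xseq k)))
  rw [← hrec k] at hstep
  have hδ0 : 0 < δ := by linarith
  have hcomp : η / 2 * (‖C (f' (xseq k)) - f' (xseq k)‖ ^ 2 - ‖f' (xseq k)‖ ^ 2)
      ≤ η / 2 * (-(1 / δ) * ‖f' (xseq k)‖ ^ 2) := by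
    gcongr
    linarith [hB3 (f' (xseq k))]
  have hpl : η / (2 * δ) * (2 * μhat * (f (xseq k) - finf)) ≤ η / (2 * δ) * ‖f' (xseq k)‖ ^ 2 := by
    gcongr
    exact hPL (xseq k)
  calc f (xseq (k + 1)) - finf
      ≤ f (xseq k) - finf - η / (2 * δ) * ‖f' (xseq k)‖ ^ 2 := by
        have : η / 2 * (-(1 / δ) * ‖f' (xseq k)‖ ^ 2) = -(η / (2 * δ) * ‖f' (xseq k)‖ ^ 2) := by
          field_simp
        linarith
    _ ≤ f (xseq k) - finf - η / (2 * δ) * (2 * μhat * (f (xseq k) - finf)) := by gcongr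
    _ = (1 - η * μhat / δ) * (f (xseq k) - finf) := by
        field_simp
end

section
/- Fix x ∈ ℝ^d and 0 ≤ ε₂ < 1, and for each i let x̃_i ∈ ℝ^d satisfy ‖x̃_i − prox_{γf_i}(x)‖² ≤ ε₂ · ‖x − prox_{γf_i}(x)‖². Define the biased gradient estimator g(x) = γ∇M^γ(x) − (1/n)∑_i (x̃_i − prox_{γf_i}(x)). Then ‖g(x)‖² ≤ (2ε₂γL_max/(1 + γL_max)) · (γM^γ(x) − γM^γ_inf) + (1 + 4√ε₂ · L_max/μ) · ‖γ∇M^γ(x)‖². -/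
section GradientInequalities

variable {E : Type*} [NormedAddCommGroup E] [InnerProductSpace ℝ E]

/-- Quadratic growth of a strongly convex function at a critical point. -/
lemma StrongConvexOn.quadratic_growth {f : E → ℝ} {μ : ℝ} {x : E}
    (hf : StrongConvexOn Set.univ μ f) (hmin : ∀ y, f x ≤ f y) (y : E) :
    μ / 2 * ‖y - x‖ ^ 2 ≤ f y - f x := by
  have hsegment : ∀ t ∈ Set.Ioo (0 : ℝ) 1, (1 - t) * (μ / 2 * ‖y - x‖ ^ 2) ≤ f y - f x := by
    intro t ht
    have hsc := hf.2 (Set.mem_univ y) (Set.mem_univ x) ht.1.le (sub_nonneg.2 ht.2.le)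
      (by ring)
    have hle := hmin (t • y + (1 - t) • x)
    simp only [smul_eq_mul] at hsc
    refine le_of_mul_le_mul_left ?_ ht.1
    linarith
  have hlim : Filter.Tendsto (fun t : ℝ => (1 - t) * (μ / 2 * ‖y - x‖ ^ 2))
      (nhdsWithin 0 (Set.Ioi 0)) (nhds (μ / 2 * ‖y - x‖ ^ 2)) := by
    have hcont : Continuous (fun t : ℝ => (1 - t) * (μ / 2 * ‖y - x‖ ^ 2)) := by fun_prop
    simpa using (hcont.tendsto 0).mono_left nhdsWithin_le_nhds
  exact le_of_tendsto hlim (Filter.mem_of_superset (Ioo_mem_nhdsGT one_pos) hsegment)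

variable [CompleteSpace E]

lemma HasGradientAt.hasDerivAt_comp_line {f : E → ℝ} {g x v : E} {t : ℝ}
    (h : HasGradientAt f g (x + t • v)) :
    HasDerivAt (fun s : ℝ => f (x + s • v)) (inner ℝ g v) t := by
  have hline : HasDerivAt (fun s : ℝ => x + s • v) v t := by
    simpa using ((hasDerivAt_id t).smul_const v).const_add x
  simpa [Function.comp_def] using h.hasFDerivAt.comp_hasDerivAt t hline

/-- First-order lower bound for a convex function. -/
lemma ConvexOn.add_inner_le_of_hasGradientAt {f : E → ℝ} {g x : E}
    (hf : ConvexOn ℝ Set.univ f) (h : HasGradientAt f g x) (y : E) :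
    f x + inner ℝ g (y - x) ≤ f y := by
  have hconv : ConvexOn ℝ Set.univ (fun t : ℝ => f (x + t • (y - x))) := by
    have hcomp := hf.comp_affineMap (AffineMap.lineMap x y : ℝ →ᵃ[ℝ] E)
    simpa [Function.comp_def, AffineMap.lineMap_apply, add_comm] using hcomp
  have hderiv : HasDerivAt (fun s : ℝ => f (x + s • (y - x))) (inner ℝ g (y - x)) 0 :=
    HasGradientAt.hasDerivAt_comp_line (by simpa using h)
  have hslope := hconv.le_slope_of_hasDerivAt (Set.mem_univ 0) (Set.mem_univ 1) one_pos hderiv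
  simp [slope_def_field] at hslope
  linarith

/-- The descent lemma: quadratic upper bound for a function with Lipschitz gradient. -/
lemma le_add_inner_add_of_lipschitz_gradient {f : E → ℝ} {f' : E → E} {L : ℝ}
    (hf : ∀ x, HasGradientAt f (f' x) x)
    (hL : ∀ x y, ‖f' x - f' y‖ ≤ L * ‖x - y‖) (x y : E) :
    f y ≤ f x + inner ℝ (f' x) (y - x) + L / 2 * ‖y - x‖ ^ 2 := by
  set v := y - x with hv
  let φ : ℝ → ℝ := fun t => f (x + t • v) - t * inner ℝ (f' x) v - L / 2 * ‖v‖ ^ 2 * t ^ 2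
  have hφ : ∀ t, HasDerivAt φ
      (inner ℝ (f' (x + t • v)) v - inner ℝ (f' x) v - L * ‖v‖ ^ 2 * t) t := by
    intro t
    have hderiv := ((hf (x + t • v)).hasDerivAt_comp_line.sub
      ((hasDerivAt_id t).mul_const (inner ℝ (f' x) v))).sub
      ((hasDerivAt_pow 2 t).const_mul (L / 2 * ‖v‖ ^ 2))
    exact hderiv.congr_deriv (by push_cast; ring)
  have hanti : AntitoneOn φ (Set.Icc 0 1) := by
    refine antitoneOn_of_deriv_nonpos (convex_Icc 0 1)
      (fun t _ => (hφ t).continuousAt.continuousWithinAt)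
      (fun t _ => (hφ t).differentiableAt.differentiableWithinAt) fun t ht => ?_
    rw [interior_Icc] at ht
    rw [(hφ t).deriv, ← inner_sub_left]
    have hinner := real_inner_le_norm (f' (x + t • v) - f' x) v
    have hlip := hL (x + t • v) x
    rw [add_sub_cancel_left, norm_smul, Real.norm_of_nonneg ht.1.le] at hlip
    nlinarith [mul_le_mul_of_nonneg_right hlip (norm_nonneg v)]
  have hle := hanti (Set.left_mem_Icc.2 zero_le_one) (Set.right_mem_Icc.2 zero_le_one) zero_le_one
  simp only [φ, one_smul, zero_smul, hv, add_sub_cancel, add_zero] at hle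
  rw [← hv] at hle
  linarith

/-- Polyak–Łojasiewicz-type upper bound of the gradient by the suboptimality. -/
lemma norm_sq_gradient_le {f : E → ℝ} {f' : E → E} {L : ℝ} (hLpos : 0 < L)
    (hf : ∀ x, HasGradientAt f (f' x) x)
    (hL : ∀ x y, ‖f' x - f' y‖ ≤ L * ‖x - y‖) {x₀ : E} (hmin : ∀ y, f x₀ ≤ f y) (p : E) :
    ‖f' p‖ ^ 2 ≤ 2 * L * (f p - f x₀) := by
  have hdesc := le_add_inner_add_of_lipschitz_gradient hf hL p (p - L⁻¹ • f' p)
  have hle := hmin (p - L⁻¹ • f' p)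
  rw [sub_sub_cancel_left, inner_neg_right, inner_smul_right, norm_neg, norm_smul,
    real_inner_self_eq_norm_sq, Real.norm_of_nonneg (inv_pos.2 hLpos).le] at hdesc
  have heq : -(L⁻¹ * ‖f' p‖ ^ 2) + L / 2 * (L⁻¹ * ‖f' p‖) ^ 2 = -(‖f' p‖ ^ 2 / (2 * L)) := by
    field_simp
    ring
  have hdiv : ‖f' p‖ ^ 2 / (2 * L) ≤ f p - f x₀ := by linarith
  rw [div_le_iff₀ (by positivity)] at hdiv
  linarith

/-- Cocoercivity of the gradient of a convex smooth function relative to a critical point. -/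
lemma norm_sq_gradient_le_inner {f : E → ℝ} {f' : E → E} {L : ℝ} (hLpos : 0 < L)
    (hconv : ConvexOn ℝ Set.univ f) (hf : ∀ x, HasGradientAt f (f' x) x)
    (hL : ∀ x y, ‖f' x - f' y‖ ≤ L * ‖x - y‖) {x₀ : E} (hcrit : f' x₀ = 0) (p : E) :
    ‖f' p‖ ^ 2 ≤ L * inner ℝ (f' p) (p - x₀) := by
  have hmin : ∀ y, f x₀ ≤ f y := fun y => by
    simpa [hcrit] using hconv.add_inner_le_of_hasGradientAt (hf x₀) y
  have hlow := norm_sq_gradient_le hLpos hf hL hmin p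
  have hdesc := le_add_inner_add_of_lipschitz_gradient hf hL x₀ (x₀ + L⁻¹ • f' p)
  have hsub := hconv.add_inner_le_of_hasGradientAt (hf p) (x₀ + L⁻¹ • f' p)
  rw [hcrit, inner_zero_left, add_sub_cancel_left, norm_smul,
    Real.norm_of_nonneg (inv_pos.2 hLpos).le] at hdesc
  rw [add_sub_right_comm, inner_add_right, inner_smul_right, real_inner_self_eq_norm_sq,
    ← neg_sub p x₀, inner_neg_right] at hsub
  have hquad : L / 2 * (L⁻¹ * ‖f' p‖) ^ 2 = L⁻¹ * ‖f' p‖ ^ 2 - ‖f' p‖ ^ 2 / (2 * L) := by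
    field_simp
    ring
  have hdiv : ‖f' p‖ ^ 2 / (2 * L) ≤ inner ℝ (f' p) (p - x₀) - (f p - f x₀) := by linarith
  rw [div_le_iff₀ (by positivity)] at hdiv
  linarith

/-- A minimizer of the proximal objective satisfies the optimality condition. -/
lemma smul_gradient_eq_of_isMinOn_prox {f : E → ℝ} {g p x : E} {γ : ℝ} (hγ : 0 < γ)
    (hf : HasGradientAt f g p)
    (hp : IsMinOn (fun z => f z + ‖z - x‖ ^ 2 / (2 * γ)) Set.univ p) :
    γ • g = x - p := by
  have hcrit : ∀ v : E, inner ℝ g v + inner ℝ (p - x) v / γ = 0 := by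
    intro v
    have hline : HasDerivAt (fun s : ℝ => p + s • v - x) v 0 := by
      simpa using (((hasDerivAt_id (0 : ℝ)).smul_const v).const_add p).sub_const x
    have hderiv := (HasGradientAt.hasDerivAt_comp_line (v := v) (t := 0)
      (by simpa using hf)).add (hline.norm_sq.div_const (2 * γ))
    have hmin : IsLocalMin (fun s : ℝ => f (p + s • v) + ‖p + s • v - x‖ ^ 2 / (2 * γ)) 0 :=
      Filter.Eventually.of_forall fun s => by simpa using hp (Set.mem_univ (p + s • v))
    have hzero := hmin.hasDerivAt_eq_zero hderiv
    simp only [zero_smul, add_zero] at hzero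
    rw [mul_div_mul_left _ _ two_ne_zero] at hzero
    exact hzero
  refine ext_inner_right ℝ fun v => ?_
  have hv := hcrit v
  rw [inner_smul_left, ← neg_sub p x, inner_neg_left]
  simp only [conj_trivial]
  field_simp at hv
  linarith

/-- Bounds on the prox residual `x - p` of a convex smooth function with critical point `x₀`. -/
lemma prox_residual_bounds {f : E → ℝ} {f' : E → E} {L γ : ℝ} (hLpos : 0 < L) (hγ : 0 < γ)
    (hconv : ConvexOn ℝ Set.univ f) (hf : ∀ x, HasGradientAt f (f' x) x)
    (hL : ∀ x y, ‖f' x - f' y‖ ≤ L * ‖x - y‖) {x₀ p x : E} (hcrit : f' x₀ = 0)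
    (hp : IsMinOn (fun z => f z + ‖z - x‖ ^ 2 / (2 * γ)) Set.univ p) :
    (1 + γ * L) * ‖x - p‖ ^ 2
        ≤ 2 * γ * L * (γ * (f p + ‖p - x‖ ^ 2 / (2 * γ) - f x₀)) ∧
      (1 + γ * L) * ‖x - p‖ ≤ γ * L * ‖x - x₀‖ ∧
      γ * (f x - f x₀) ≤ (1 + γ * L) * inner ℝ (x - p) (x - x₀) := by
  have hmin : ∀ y, f x₀ ≤ f y := fun y => by
    simpa [hcrit] using hconv.add_inner_le_of_hasGradientAt (hf x₀) y
  have hres := smul_gradient_eq_of_isMinOn_prox hγ (hf p) hp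
  have hnorm : ‖x - p‖ ^ 2 = γ ^ 2 * ‖f' p‖ ^ 2 := by
    rw [← hres, norm_smul, mul_pow, Real.norm_of_nonneg hγ.le]
  have hinner : inner ℝ (x - p) (x - x₀) = ‖x - p‖ ^ 2 + γ * inner ℝ (f' p) (p - x₀) := by
    rw [← sub_add_sub_cancel x p x₀, inner_add_right, real_inner_self_eq_norm_sq]
    nth_rewrite 2 [← hres]
    rw [real_inner_smul_left]
  have hlow := norm_sq_gradient_le hLpos hf hL hmin p
  have hcoer := norm_sq_gradient_le_inner hLpos hconv hf hL hcrit p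
  refine ⟨?_, ?_, ?_⟩
  · rw [norm_sub_rev p x]
    have heq : 2 * γ * L * (γ * (f p + ‖x - p‖ ^ 2 / (2 * γ) - f x₀))
        = γ ^ 2 * (2 * L * (f p - f x₀)) + γ * L * ‖x - p‖ ^ 2 := by
      field_simp
      ring
    nlinarith [mul_le_mul_of_nonneg_left hlow (sq_nonneg γ)]
  · have hsq : (1 + γ * L) * ‖x - p‖ ^ 2 ≤ γ * L * (‖x - p‖ * ‖x - x₀‖) := by
      refine le_trans ?_ (mul_le_mul_of_nonneg_left (real_inner_le_norm _ _) (by positivity))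
      rw [hinner]
      nlinarith [mul_le_mul_of_nonneg_left hcoer (sq_nonneg γ)]
    rcases (norm_nonneg (x - p)).eq_or_lt with hzero | hpos
    · rw [← hzero, mul_zero]
      positivity
    · refine le_of_mul_le_mul_right ?_ hpos
      linarith
  · have hdesc := le_add_inner_add_of_lipschitz_gradient hf hL p x
    have hsub := hconv.add_inner_le_of_hasGradientAt (hf p) x₀
    rw [← neg_sub p x₀, inner_neg_right] at hsub
    have hself : γ * inner ℝ (f' p) (x - p) = ‖x - p‖ ^ 2 := by
      rw [← real_inner_smul_left, hres, real_inner_self_eq_norm_sq]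
    have hI : 0 ≤ inner ℝ (f' p) (p - x₀) := by linarith [hmin p]
    have hstep := mul_le_mul_of_nonneg_left hdesc hγ.le
    rw [hinner]
    have hγL := mul_pos hγ hLpos
    nlinarith [mul_le_mul_of_nonneg_left hsub hγ.le,
      mul_nonneg (mul_nonneg hγL.le hγ.le) hI, mul_nonneg hγL.le (sq_nonneg ‖x - p‖)]

end GradientInequalities


theorem rel_estimator_norm
    {d n : ℕ} (hn : 1 ≤ n)
    (f : Fin n → EuclideanSpace ℝ (Fin d) → ℝ)
    (f' : Fin n → EuclideanSpace ℝ (Fin d) → EuclideanSpace ℝ (Fin d))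
    (L : Fin n → ℝ) (hLpos : ∀ i, 0 < L i)
    (hdiff : ∀ i x, HasGradientAt (f i) (f' i x) x)
    (hconv : ∀ i, ConvexOn ℝ Set.univ (f i))
    (hsmooth : ∀ i x y, ‖f' i x - f' i y‖ ≤ L i * ‖x - y‖)
    (Lmax : ℝ) (hLmax : IsGreatest (Set.range L) Lmax)
    (xstar : EuclideanSpace ℝ (Fin d)) (hinterp : ∀ i, f' i xstar = 0)
    (μ : ℝ) (hμ : 0 < μ)
    (hsc : StrongConvexOn Set.univ μ (fun x => (1 / (n : ℝ)) * ∑ i, f i x))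
    (γ : ℝ) (hγ : 0 < γ)
    (prox : Fin n → EuclideanSpace ℝ (Fin d) → EuclideanSpace ℝ (Fin d))
    (hprox : ∀ i x, IsMinOn (fun z => f i z + ‖z - x‖ ^ 2 / (2 * γ)) Set.univ (prox i x))
    (hproxu : ∀ i x q, IsMinOn (fun z => f i z + ‖z - x‖ ^ 2 / (2 * γ)) Set.univ q → q = prox i x)
    (M : EuclideanSpace ℝ (Fin d) → ℝ)
    (hM : ∀ x, M x = (1 / (n : ℝ)) * ∑ i, (f i (prox i x) + ‖prox i x - x‖ ^ 2 / (2 * γ)))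
    (M' : EuclideanSpace ℝ (Fin d) → EuclideanSpace ℝ (Fin d))
    (hM' : ∀ x, M' x = (1 / ((n : ℝ) * γ)) • ∑ i, (x - prox i x))
    (hMdiff : ∀ x, HasGradientAt M (M' x) x)
    (Minf : ℝ) (hMinf : Minf = M xstar) (hMinfLB : ∀ x, Minf ≤ M x)
    (x : EuclideanSpace ℝ (Fin d)) (xtil : Fin n → EuclideanSpace ℝ (Fin d))
    (ε₂ : ℝ) (hε₂ : 0 ≤ ε₂) (hε₂lt : ε₂ < 1)
    (happrox : ∀ i, ‖xtil i - prox i x‖ ^ 2 ≤ ε₂ * ‖x - prox i x‖ ^ 2)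
    (g : EuclideanSpace ℝ (Fin d))
    (hg : g = γ • M' x - (1 / (n : ℝ)) • ∑ i, (xtil i - prox i x))
    : ‖g‖ ^ 2 ≤ 2 * ε₂ * γ * Lmax / (1 + γ * Lmax) * (γ * M x - γ * Minf)
      + (1 + 4 * Real.sqrt ε₂ * Lmax / μ) * ‖γ • M' x‖ ^ 2 := by
  have hn0 : (0 : ℝ) < n := by exact_mod_cast hn
  obtain ⟨i₀, hi₀⟩ := hLmax.1
  have hLmax_pos : 0 < Lmax := hi₀ ▸ hLpos i₀
  have hc : 0 < 1 + γ * Lmax := by positivity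
  have hbounds i := prox_residual_bounds hLmax_pos hγ (hconv i) (hdiff i)
    (fun y z => (hsmooth i y z).trans
      (mul_le_mul_of_nonneg_right (hLmax.2 ⟨i, rfl⟩) (norm_nonneg _))) (hinterp i) (hprox i x)
  set D := ‖x - xstar‖ with hD
  set e := (1 / (n : ℝ)) • ∑ i, (xtil i - prox i x) with he
  set G := γ • M' x with hG
  have hG_eq : G = (1 / (n : ℝ)) • ∑ i, (x - prox i x) := by
    rw [hG, hM', smul_smul]
    congr 1
    field_simp
  have hMstar : M xstar ≤ (1 / (n : ℝ)) * ∑ i, f i xstar := by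
    rw [hM]
    gcongr with i
    simpa using hprox i xstar (Set.mem_univ xstar)
  have he_norm : ‖e‖ ≤ (1 / (n : ℝ)) * ∑ i, ‖xtil i - prox i x‖ := by
    rw [he, norm_smul, Real.norm_of_nonneg (by positivity)]
    gcongr
    exact norm_sum_le _ _
  have he_sq : ‖e‖ ^ 2 ≤ 2 * ε₂ * γ * Lmax / (1 + γ * Lmax) * (γ * M x - γ * Minf) := by
    have hjensen : ‖e‖ ^ 2 ≤ (1 / (n : ℝ)) * ∑ i, ‖xtil i - prox i x‖ ^ 2 := by
      have hcs := sq_sum_le_card_mul_sum_sq (s := Finset.univ)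
        (f := fun i => ‖xtil i - prox i x‖)
      rw [Finset.card_univ, Fintype.card_fin] at hcs
      calc ‖e‖ ^ 2 ≤ ((1 / (n : ℝ)) * ∑ i, ‖xtil i - prox i x‖) ^ 2 := by gcongr
        _ = (1 / (n : ℝ)) ^ 2 * (∑ i, ‖xtil i - prox i x‖) ^ 2 := mul_pow _ _ _
        _ ≤ (1 / (n : ℝ)) ^ 2 * (n * ∑ i, ‖xtil i - prox i x‖ ^ 2) := by gcongr
        _ = (1 / (n : ℝ)) * ∑ i, ‖xtil i - prox i x‖ ^ 2 := by field_simp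
    have hterm i : ‖xtil i - prox i x‖ ^ 2 ≤ 2 * ε₂ * γ * Lmax / (1 + γ * Lmax) *
        (γ * (f i (prox i x) + ‖prox i x - x‖ ^ 2 / (2 * γ) - f i xstar)) := by
      refine (happrox i).trans ?_
      rw [div_mul_eq_mul_div, le_div_iff₀ hc]
      linarith [mul_le_mul_of_nonneg_left (hbounds i).1 hε₂]
    calc ‖e‖ ^ 2 ≤ (1 / (n : ℝ)) * ∑ i, ‖xtil i - prox i x‖ ^ 2 := hjensen
      _ ≤ (1 / (n : ℝ)) * ∑ i, 2 * ε₂ * γ * Lmax / (1 + γ * Lmax) *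
          (γ * (f i (prox i x) + ‖prox i x - x‖ ^ 2 / (2 * γ) - f i xstar)) := by
        gcongr with i
        exact hterm i
      _ = 2 * ε₂ * γ * Lmax / (1 + γ * Lmax) *
          (γ * (M x - (1 / (n : ℝ)) * ∑ i, f i xstar)) := by
        rw [hM, ← mul_sub, ← Finset.sum_sub_distrib, ← Finset.mul_sum, ← Finset.mul_sum]
        ring
      _ ≤ 2 * ε₂ * γ * Lmax / (1 + γ * Lmax) * (γ * M x - γ * Minf) := by
        rw [← mul_sub, hMinf]
        gcongr
  have he_dist : (1 + γ * Lmax) * ‖e‖ ≤ Real.sqrt ε₂ * (γ * Lmax * D) := by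
    have hterm i : ‖xtil i - prox i x‖ ≤ Real.sqrt ε₂ * (γ * Lmax * D) / (1 + γ * Lmax) := by
      have hroot : ‖xtil i - prox i x‖ ≤ Real.sqrt ε₂ * ‖x - prox i x‖ := by
        refine le_of_sq_le_sq ?_ (by positivity)
        rw [mul_pow, Real.sq_sqrt hε₂]
        exact happrox i
      rw [le_div_iff₀ hc]
      calc ‖xtil i - prox i x‖ * (1 + γ * Lmax)
          ≤ Real.sqrt ε₂ * ‖x - prox i x‖ * (1 + γ * Lmax) := by gcongr
        _ = Real.sqrt ε₂ * ((1 + γ * Lmax) * ‖x - prox i x‖) := by ring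
        _ ≤ Real.sqrt ε₂ * (γ * Lmax * D) := by
          exact mul_le_mul_of_nonneg_left (hbounds i).2.1 (Real.sqrt_nonneg _)
    have hsum := Finset.sum_le_sum fun i (_ : i ∈ Finset.univ) => hterm i
    rw [Finset.sum_const, Finset.card_univ, Fintype.card_fin, nsmul_eq_mul] at hsum
    rw [← le_div_iff₀' hc]
    refine he_norm.trans ?_
    rwa [one_div_mul_eq_div, div_le_iff₀' hn0]
  have hG_dist : γ * μ * D ≤ 2 * (1 + γ * Lmax) * ‖G‖ := by
    have hmin y : (1 / (n : ℝ)) * ∑ i, f i xstar ≤ (1 / (n : ℝ)) * ∑ i, f i y := by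
      gcongr with i
      simpa [hinterp i] using (hconv i).add_inner_le_of_hasGradientAt (hdiff i xstar) y
    have hgrowth := hsc.quadratic_growth hmin x
    have hsum : γ * ((1 / (n : ℝ)) * ∑ i, f i x - (1 / (n : ℝ)) * ∑ i, f i xstar)
        ≤ (1 + γ * Lmax) * inner ℝ G (x - xstar) := by
      calc _ = (1 / (n : ℝ)) * ∑ i, γ * (f i x - f i xstar) := by
            rw [← Finset.mul_sum, Finset.sum_sub_distrib]
            ring
        _ ≤ (1 / (n : ℝ)) * ∑ i, (1 + γ * Lmax) * inner ℝ (x - prox i x) (x - xstar) := by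
            exact mul_le_mul_of_nonneg_left (Finset.sum_le_sum fun i _ => (hbounds i).2.2)
              (by positivity)
        _ = _ := by
            rw [hG_eq, real_inner_smul_left, sum_inner, ← Finset.mul_sum]
            ring
    have hinner := mul_le_mul_of_nonneg_left (real_inner_le_norm G (x - xstar)) hc.le
    have hsq : γ * (μ / 2 * D ^ 2) ≤ (1 + γ * Lmax) * (‖G‖ * D) :=
      (mul_le_mul_of_nonneg_left hgrowth hγ.le).trans (hsum.trans hinner)
    rcases (norm_nonneg (x - xstar)).eq_or_lt with hzero | hpos
    · rw [hD, ← hzero, mul_zero]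
      positivity
    · rw [← hD] at hpos
      refine le_of_mul_le_mul_right ?_ hpos
      linarith
  have he_G : ‖e‖ ≤ 2 * Real.sqrt ε₂ * Lmax / μ * ‖G‖ := by
    rw [div_mul_eq_mul_div, le_div_iff₀ hμ]
    refine le_of_mul_le_mul_left ?_ hc
    calc (1 + γ * Lmax) * (‖e‖ * μ) = (1 + γ * Lmax) * ‖e‖ * μ := by ring
      _ ≤ Real.sqrt ε₂ * (γ * Lmax * D) * μ := by gcongr
      _ = Real.sqrt ε₂ * Lmax * (γ * μ * D) := by ring
      _ ≤ Real.sqrt ε₂ * Lmax * (2 * (1 + γ * Lmax) * ‖G‖) := by gcongr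
      _ = (1 + γ * Lmax) * (2 * Real.sqrt ε₂ * Lmax * ‖G‖) := by ring
  have hcross : -(2 * inner ℝ G e) ≤ 4 * Real.sqrt ε₂ * Lmax / μ * ‖G‖ ^ 2 := by
    calc -(2 * inner ℝ G e) ≤ 2 * (‖G‖ * ‖e‖) := by
          linarith [neg_abs_le (inner ℝ G e), abs_real_inner_le_norm G e]
      _ ≤ 2 * (‖G‖ * (2 * Real.sqrt ε₂ * Lmax / μ * ‖G‖)) := by gcongr
      _ = 4 * Real.sqrt ε₂ * Lmax / μ * ‖G‖ ^ 2 := by ring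
  rw [hg, norm_sub_sq_real]
  linarith
end

section
/- Under the stated setup, for every x ∈ ℝ^d, ‖x − x⋆‖ ≤ (2(1 + γL_max)/μ) · ‖∇M^γ(x)‖. -/
open scoped RealInnerProductSpace Topology

/-- Quadratic lower bound of a strongly convex function at a point of differentiability. -/
theorem StrongConvexOn.add_inner_add_le {E : Type*} [NormedAddCommGroup E]
    [InnerProductSpace ℝ E] [CompleteSpace E] {f : E → ℝ} {m : ℝ} {x g : E}
    (hf : StrongConvexOn Set.univ m f) (hg : HasGradientAt f g x) (y : E) :
    f x + ⟪g, y - x⟫ + m / 2 * ‖y - x‖ ^ 2 ≤ f y := by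
  have hline : HasDerivAt (fun t : ℝ => x + t • (y - x)) (y - x) 0 := by
    simpa using ((hasDerivAt_id (0 : ℝ)).smul_const (y - x)).const_add x
  have hderiv : HasDerivAt (fun t : ℝ => f (x + t • (y - x))) ⟪g, y - x⟫ 0 := by
    have hg' : HasFDerivAt f (InnerProductSpace.toDual ℝ E g) (x + (0 : ℝ) • (y - x)) := by
      simpa using hg.hasFDerivAt
    simpa [Function.comp_def] using hg'.comp_hasDerivAt (0 : ℝ) hline
  have hslope := hderiv.tendsto_slope_zero_right
  have hbound : Filter.Tendsto
      (fun t : ℝ => f y - f x - (1 - t) * (m / 2 * ‖y - x‖ ^ 2)) (𝓝[>] 0)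
      (𝓝 (f y - f x - (1 - 0) * (m / 2 * ‖y - x‖ ^ 2))) :=
    (Continuous.tendsto (by fun_prop) 0).mono_left nhdsWithin_le_nhds
  have hle := le_of_tendsto_of_tendsto hslope hbound <| by
    filter_upwards [Ioo_mem_nhdsGT (zero_lt_one' ℝ)] with t ht
    have h := hf.2 (Set.mem_univ x) (Set.mem_univ y) (sub_nonneg.2 ht.2.le) ht.1.le
      (sub_add_cancel 1 t)
    have hpt : (1 - t) • x + t • y = x + t • (y - x) := by module
    rw [hpt, norm_sub_rev] at h
    simp only [smul_eq_mul, zero_add, zero_smul, add_zero] at h ⊢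
    rw [inv_mul_le_iff₀ ht.1]
    linarith
  linarith

/-- First-order optimality condition for the proximal point. -/
theorem IsMinOn.sub_eq_smul_gradient {E : Type*} [NormedAddCommGroup E]
    [InnerProductSpace ℝ E] [CompleteSpace E] {f : E → ℝ} {γ : ℝ} (hγ : 0 < γ) {x p g : E}
    (hmin : IsMinOn (fun z => f z + ‖z - x‖ ^ 2 / (2 * γ)) Set.univ p)
    (hg : HasGradientAt f g p) : x - p = γ • g := by
  have hsq := ((hasFDerivAt_id (𝕜 := ℝ) p).sub_const x).norm_sq.mul_const (2 * γ)⁻¹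
  have hzero := (hmin.isLocalMin Filter.univ_mem).hasFDerivAt_eq_zero (hg.hasFDerivAt.add hsq)
  refine ext_inner_right ℝ fun v => ?_
  have hv := DFunLike.congr_fun hzero v
  simp at hv
  rw [real_inner_smul_left, inner_sub_left]
  field_simp at hv
  linarith

/-- A point of a convex smooth function at which the gradient vanishes: the suboptimality at `x`
is controlled by the gradient at the point `p` reached by an implicit gradient step. -/
theorem ConvexOn.sub_le_inner_of_implicit_step {E : Type*} [NormedAddCommGroup E]
    [InnerProductSpace ℝ E] [CompleteSpace E] {f : E → ℝ} {f' : E → E} {L γ : ℝ}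
    (hf : ConvexOn ℝ Set.univ f) (hdiff : ∀ x, HasGradientAt f (f' x) x)
    (hsmooth : ∀ x y, ‖f' x - f' y‖ ≤ L * ‖x - y‖) (hL : 0 ≤ L) (hγ : 0 < γ) {z x p : E}
    (hz : f' z = 0) (hp : x - p = γ • f' p) :
    f x - f z ≤ (1 + γ * L) * ⟪f' p, x - z⟫ := by
  have hgrad (a b : E) : f a + ⟪f' a, b - a⟫ ≤ f b := by
    simpa using (strongConvexOn_zero.2 hf).add_inner_add_le (hdiff a) b
  have hzp : f z ≤ f p := by simpa [hz] using hgrad z p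
  have hpz := hgrad p z
  have hxp := hgrad x p
  have hlip : ⟪f' x - f' p, x - p⟫ ≤ L * ‖x - p‖ ^ 2 :=
    calc ⟪f' x - f' p, x - p⟫ ≤ ‖f' x - f' p‖ * ‖x - p‖ := real_inner_le_norm _ _
      _ ≤ L * ‖x - p‖ * ‖x - p‖ := by gcongr; exact hsmooth x p
      _ = L * ‖x - p‖ ^ 2 := by ring
  have hsplit : ⟪f' p, x - z⟫ = γ * ‖f' p‖ ^ 2 - ⟪f' p, z - p⟫ := by
    rw [← sub_sub_sub_cancel_right x z p, inner_sub_right, hp, real_inner_smul_right,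
      real_inner_self_eq_norm_sq]
  have hstep : ⟪f' p, x - p⟫ = γ * ‖f' p‖ ^ 2 := by
    rw [hp, real_inner_smul_right, real_inner_self_eq_norm_sq]
  have hnorm : ‖x - p‖ ^ 2 = γ ^ 2 * ‖f' p‖ ^ 2 := by
    rw [hp, norm_smul, mul_pow, Real.norm_eq_abs, sq_abs]
  rw [inner_sub_left, hstep, hnorm] at hlip
  rw [← neg_sub x p, inner_neg_right] at hxp
  rw [hsplit]
  have hγL : 0 ≤ γ * L := by positivity
  nlinarith [mul_nonneg hγL (sub_nonneg.2 hzp), mul_le_mul_of_nonneg_left hpz hγL]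

theorem dist_le_grad
    {d n : ℕ} (hn : 1 ≤ n)
    (f : Fin n → EuclideanSpace ℝ (Fin d) → ℝ)
    (f' : Fin n → EuclideanSpace ℝ (Fin d) → EuclideanSpace ℝ (Fin d))
    (L : Fin n → ℝ) (hLpos : ∀ i, 0 < L i)
    (hdiff : ∀ i x, HasGradientAt (f i) (f' i x) x)
    (hconv : ∀ i, ConvexOn ℝ Set.univ (f i))
    (hsmooth : ∀ i x y, ‖f' i x - f' i y‖ ≤ L i * ‖x - y‖)
    (Lmax : ℝ) (hLmax : IsGreatest (Set.range L) Lmax)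
    (xstar : EuclideanSpace ℝ (Fin d)) (hinterp : ∀ i, f' i xstar = 0)
    (μ : ℝ) (hμ : 0 < μ)
    (hsc : StrongConvexOn Set.univ μ (fun x => (1 / (n : ℝ)) * ∑ i, f i x))
    (γ : ℝ) (hγ : 0 < γ)
    (prox : Fin n → EuclideanSpace ℝ (Fin d) → EuclideanSpace ℝ (Fin d))
    (hprox : ∀ i x, IsMinOn (fun z => f i z + ‖z - x‖ ^ 2 / (2 * γ)) Set.univ (prox i x))
    (hproxu : ∀ i x q, IsMinOn (fun z => f i z + ‖z - x‖ ^ 2 / (2 * γ)) Set.univ q → q = prox i x)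
    (M : EuclideanSpace ℝ (Fin d) → ℝ)
    (hM : ∀ x, M x = (1 / (n : ℝ)) * ∑ i, (f i (prox i x) + ‖prox i x - x‖ ^ 2 / (2 * γ)))
    (M' : EuclideanSpace ℝ (Fin d) → EuclideanSpace ℝ (Fin d))
    (hM' : ∀ x, M' x = (1 / ((n : ℝ) * γ)) • ∑ i, (x - prox i x))
    (hMdiff : ∀ x, HasGradientAt M (M' x) x)
    : ∀ x : EuclideanSpace ℝ (Fin d), ‖x - xstar‖ ≤ 2 * (1 + γ * Lmax) / μ * ‖M' x‖ := by
  intro x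
  have hn0 : (0 : ℝ) < n := by exact_mod_cast hn
  have hprox_eq (i : Fin n) : x - prox i x = γ • f' i (prox i x) :=
    (hprox i x).sub_eq_smul_gradient hγ (hdiff i _)
  have hM'_inner : (n : ℝ) * ⟪M' x, x - xstar⟫ = ∑ i, ⟪f' i (prox i x), x - xstar⟫ := by
    simp_rw [hM', hprox_eq]
    rw [← Finset.smul_sum, smul_smul, real_inner_smul_left, sum_inner]
    field_simp
  have hLmax_nonneg : 0 ≤ Lmax := by
    obtain ⟨i, rfl⟩ := hLmax.1
    exact (hLpos i).le
  have hsum : ∑ i, (f i x - f i xstar) ≤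
      (1 + γ * Lmax) * ∑ i, ⟪f' i (prox i x), x - xstar⟫ := by
    rw [Finset.mul_sum]
    refine Finset.sum_le_sum fun i _ => ?_
    refine (hconv i).sub_le_inner_of_implicit_step (hdiff i) (fun a b => ?_) hLmax_nonneg hγ
      (hinterp i) (hprox_eq i)
    exact (hsmooth i a b).trans (by gcongr; exact hLmax.2 ⟨i, rfl⟩)
  have hgrad : HasGradientAt (fun x => (1 / (n : ℝ)) * ∑ i, f i x) 0 xstar := by
    rw [hasGradientAt_iff_hasFDerivAt]
    have h := (HasFDerivAt.fun_sum (u := Finset.univ)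
      fun i _ => (hdiff i xstar).hasFDerivAt).const_mul (1 / (n : ℝ))
    simpa [hinterp] using h
  have hlower := hsc.add_inner_add_le hgrad x
  rw [Finset.sum_sub_distrib, ← hM'_inner] at hsum
  simp only [inner_zero_left, add_zero] at hlower
  have hupper : (1 / (n : ℝ)) * ∑ i, f i x - (1 / (n : ℝ)) * ∑ i, f i xstar ≤
      (1 + γ * Lmax) * ⟪M' x, x - xstar⟫ := by
    rw [← mul_sub, one_div, inv_mul_le_iff₀ hn0]
    linarith
  have hcs := mul_le_mul_of_nonneg_left (real_inner_le_norm (M' x) (x - xstar))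
    (by positivity : 0 ≤ 1 + γ * Lmax)
  rcases (norm_nonneg (x - xstar)).eq_or_lt with h0 | hpos
  · rw [← h0]
    positivity
  · rw [div_mul_eq_mul_div, le_div_iff₀ hμ]
    refine le_of_mul_le_mul_right ?_ hpos
    linarith
end
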